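/- Let G = (V, E, w) be a connected weighted graph with positive edge weights, let T = (V, F, w) be a spanning tree of G, with Laplacians L_G and L_T, let M be the Moore–Penrose pseudoinverse of L_T, and set S = st_T(G), the stretch of G with respect to T. Then: (i) every eigenvalue of L_G · M (root of its characteristic polynomial over ℂ, counted with multiplicity) is either 0 or a real number in the interval [1, S]; and (ii) the number of eigenvalues of L_G · M exceeding S^{2/3} is at most S^{1/3}. In particular, all but at most S^{1/3} of the nonzero eigenvalues of L_G · M lie in the interval [1, S^{2/3}]. -/

import Mathlib

open Matrix

/-- The rank-one Laplacian contribution `(ψ_u - ψ_v)(ψ_u - ψ_v)ᵀ` of an edge,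
as a function on unordered pairs. -/
noncomputable def edgeLap {V : Type*} [DecidableEq V] : Sym2 V → Matrix V V ℝ :=
  Sym2.lift ⟨fun u v =>
      Matrix.vecMulVec (Pi.single u 1 - Pi.single v 1) (Pi.single u 1 - Pi.single v 1),
    by
      intro u v
      ext i j
      simp [Matrix.vecMulVec]
      ring⟩

/-- The Laplacian of a weighted graph: `L_G = Σ_{e∈E} w(e) (ψ_u - ψ_v)(ψ_u - ψ_v)ᵀ`. -/
noncomputable def lapW {V : Type*} [Fintype V] [DecidableEq V]
    (G : SimpleGraph V) [DecidableRel G.Adj] (w : Sym2 V → ℝ) : Matrix V V ℝ :=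
  ∑ e ∈ G.edgeFinset, w e • edgeLap e

/-- The sum `Σ_i 1 / w(e_i)` over the edges `e_1, …, e_k` of the unique simple path in the
tree `T` from `u` to `v`. -/
noncomputable def treePathWeight {V : Type*} (T : SimpleGraph V) (hT : T.IsTree)
    (w : Sym2 V → ℝ) (u v : V) : ℝ :=
  (((hT.existsUnique_path u v).choose.edges).map fun e => 1 / w e).sum

lemma treePathWeight_symm {V : Type*} (T : SimpleGraph V) (hT : T.IsTree)
    (w : Sym2 V → ℝ) (u v : V) :
    treePathWeight T hT w u v = treePathWeight T hT w v u := by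
  have h1 := (hT.existsUnique_path u v).choose_spec
  have h2 := (hT.existsUnique_path v u).choose_spec
  have hrev : (hT.existsUnique_path u v).choose.reverse = (hT.existsUnique_path v u).choose :=
    h2.2 _ h1.1.reverse
  unfold treePathWeight
  rw [← hrev, SimpleGraph.Walk.edges_reverse, List.map_reverse, List.sum_reverse]

/-- The stretch `st_T(e) = w(e) · Σ_i 1 / w(e_i)` of an unordered pair `e`, where
`e_1, …, e_k` are the edges of the unique simple path in `T` joining the endpoints of `e`. -/
noncomputable def stretchEdge {V : Type*} (T : SimpleGraph V) (hT : T.IsTree)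
    (w : Sym2 V → ℝ) : Sym2 V → ℝ :=
  Sym2.lift ⟨fun u v => w s(u, v) * treePathWeight T hT w u v,
    by
      intro u v
      simp only []
      rw [Sym2.eq_swap, treePathWeight_symm]⟩

/-- The stretch of `G` with respect to the spanning tree `T`:
`st_T(G) = Σ_{e∈E} st_T(e)`. -/
noncomputable def stretch {V : Type*} [Fintype V] [DecidableEq V]
    (G : SimpleGraph V) [DecidableRel G.Adj] (T : SimpleGraph V) (hT : T.IsTree)
    (w : Sym2 V → ℝ) : ℝ :=
  ∑ e ∈ G.edgeFinset, stretchEdge T hT w e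


lemma edgeLap_mk {V : Type*} [DecidableEq V] (u v : V) :
    edgeLap s(u, v) = Matrix.vecMulVec (Pi.single u 1 - Pi.single v 1 : V → ℝ)
      (Pi.single u 1 - Pi.single v 1) := rfl

lemma edgeLap_posSemidef {V : Type*} [Fintype V] [DecidableEq V] (e : Sym2 V) :
    (edgeLap e).PosSemidef := by
  induction e with
  | h u v =>
    rw [edgeLap_mk]
    have := posSemidef_vecMulVec_self_star (Pi.single u 1 - Pi.single v 1 : V → ℝ)
    simpa using this

lemma edgeLap_mulVec {V : Type*} [Fintype V] [DecidableEq V] (u v : V) (p : V → ℝ) :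
    edgeLap s(u, v) *ᵥ p = (p u - p v) • (Pi.single u 1 - Pi.single v 1 : V → ℝ) := by
  rw [edgeLap_mk, vecMulVec_mulVec]
  ext i
  simp [sub_dotProduct, mul_comm]

lemma sum_edgeLap_posSemidef {V : Type*} [Fintype V] [DecidableEq V] (s : Finset (Sym2 V))
    (w : Sym2 V → ℝ) (hw : ∀ e ∈ s, 0 < w e) :
    (∑ e ∈ s, w e • edgeLap e).PosSemidef :=
  posSemidef_sum _ fun e he => (edgeLap_posSemidef e).smul (hw e he).le

lemma lapW_sub_posSemidef {V : Type*} [Fintype V] [DecidableEq V]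
    (G T : SimpleGraph V) [DecidableRel G.Adj] [DecidableRel T.Adj] (hTG : T ≤ G)
    (w : Sym2 V → ℝ) (hw : ∀ e ∈ G.edgeSet, 0 < w e) :
    (lapW G w - lapW T w).PosSemidef := by
  have hsub : T.edgeFinset ⊆ G.edgeFinset := SimpleGraph.edgeFinset_mono hTG
  have : lapW G w - lapW T w = ∑ e ∈ G.edgeFinset \ T.edgeFinset, w e • edgeLap e := by
    rw [lapW, lapW, ← Finset.sum_sdiff hsub]
    simp
  rw [this]
  apply sum_edgeLap_posSemidef
  intro e he
  apply hw
  simp only [Finset.mem_sdiff, SimpleGraph.mem_edgeFinset] at he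
  exact he.1

/-- potential of a single tree edge -/
lemma exists_edge_potential {V : Type*} [Fintype V] [DecidableEq V]
    (T : SimpleGraph V) [DecidableRel T.Adj] (hT : T.IsTree) (w : Sym2 V → ℝ)
    (hw : ∀ e ∈ T.edgeSet, 0 < w e) (u a : V) (h : T.Adj u a) :
    ∃ p : V → ℝ, lapW T w *ᵥ p = Pi.single u 1 - Pi.single a 1 ∧
      p u - p a = 1 / w s(u, a) ∧
      ∀ x y, T.Adj x y → s(x, y) ≠ s(u, a) → p x = p y := by
  classical
  let p : V → ℝ := fun x =>
    if (T.deleteEdges {s(u, a)}).Reachable u x then 1 / w s(u, a) else 0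
  have hpos := hw s(u, a) h
  have hbr : ¬ (T.deleteEdges {s(u, a)}).Reachable u a :=
    SimpleGraph.isBridge_iff.1
      (SimpleGraph.isAcyclic_iff_forall_adj_isBridge.1 hT.isAcyclic h)
  have h2 : p u - p a = 1 / w s(u, a) := by
    simp [p, hbr]
  have h3 : ∀ x y, T.Adj x y → s(x, y) ≠ s(u, a) → p x = p y := by
    intro x y hxy hne
    have had : (T.deleteEdges {s(u, a)}).Adj x y := by
      rw [SimpleGraph.deleteEdges_adj]
      exact ⟨hxy, by simpa using hne⟩
    have : (T.deleteEdges {s(u, a)}).Reachable u x ↔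
        (T.deleteEdges {s(u, a)}).Reachable u y :=
      ⟨fun q => q.trans had.reachable, fun q => q.trans had.symm.reachable⟩
    simp only [p, this]
  refine ⟨p, ?_, h2, h3⟩
  rw [lapW, Matrix.sum_mulVec, Finset.sum_eq_single s(u, a)]
  · rw [smul_mulVec, edgeLap_mulVec, h2, smul_smul, mul_one_div_cancel hpos.ne', one_smul]
  · intro e he hne
    induction e with
    | h x y =>
      rw [SimpleGraph.mem_edgeFinset, SimpleGraph.mem_edgeSet] at he
      rw [smul_mulVec, edgeLap_mulVec, h3 x y he hne, sub_self, zero_smul, smul_zero]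
  · intro hn
    exact absurd (by simpa using h) hn

lemma const_along_walk {V : Type*} (T : SimpleGraph V) (p : V → ℝ) (e : Sym2 V)
    (h : ∀ x y, T.Adj x y → s(x, y) ≠ e → p x = p y) {u v : V} (q : T.Walk u v)
    (hq : e ∉ q.edges) : p u = p v := by
  induction q with
  | nil => rfl
  | cons hadj q ih =>
    rw [SimpleGraph.Walk.edges_cons, List.mem_cons, not_or] at hq
    exact (h _ _ hadj (Ne.symm hq.1)).trans (ih hq.2)

lemma exists_path_potential {V : Type*} [Fintype V] [DecidableEq V]
    (T : SimpleGraph V) [DecidableRel T.Adj] (hT : T.IsTree) (w : Sym2 V → ℝ)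
    (hw : ∀ e ∈ T.edgeSet, 0 < w e) {u v : V} (q : T.Walk u v) (hq : q.IsPath) :
    ∃ p : V → ℝ, lapW T w *ᵥ p = Pi.single u 1 - Pi.single v 1 ∧
      p u - p v = (q.edges.map fun e => 1 / w e).sum ∧
      ∀ x y, T.Adj x y → s(x, y) ∉ q.edges → p x = p y := by
  induction q with
  | nil => exact ⟨0, by simp, by simp, by simp⟩
  | @cons u a v hadj q ih =>
    obtain ⟨p', h1, h2, h3⟩ := ih hq.of_cons
    obtain ⟨f, g1, g2, g3⟩ := exists_edge_potential T hT w hw u a hadj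
    have hnot : s(u, a) ∉ q.edges := by
      have := hq.isTrail
      rw [SimpleGraph.Walk.isTrail_cons] at this
      exact this.2
    refine ⟨f + p', ?_, ?_, ?_⟩
    · rw [mulVec_add, h1, g1]; abel
    · have e1 := const_along_walk T f _ g3 q hnot
      have e2 := h3 u a hadj hnot
      rw [SimpleGraph.Walk.edges_cons, List.map_cons, List.sum_cons, ← h2, ← g2]
      simp only [Pi.add_apply]
      linarith
    · intro x y hxy hn
      rw [SimpleGraph.Walk.edges_cons, List.mem_cons, not_or] at hn
      simp only [Pi.add_apply]
      rw [g3 x y hxy hn.1, h3 x y hxy hn.2]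

lemma lapW_isSymm {V : Type*} [Fintype V] [DecidableEq V]
    (G : SimpleGraph V) [DecidableRel G.Adj] (w : Sym2 V → ℝ)
    (hw : ∀ e ∈ G.edgeSet, 0 < w e) : (lapW G w).PosSemidef :=
  sum_edgeLap_posSemidef _ _ fun e he => hw e (by simpa using he)

lemma trace_lapW_mul {V : Type*} [Fintype V] [DecidableEq V]
    (G T : SimpleGraph V) [DecidableRel G.Adj] [DecidableRel T.Adj]
    (hT : T.IsTree) (w : Sym2 V → ℝ) (hw : ∀ e ∈ T.edgeSet, 0 < w e)
    (M : Matrix V V ℝ) (hM1 : lapW T w * M * lapW T w = lapW T w) :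
    (lapW G w * M).trace = stretch G T hT w := by
  rw [lapW, Finset.sum_mul, trace_sum, stretch]
  refine Finset.sum_congr rfl fun e _ => ?_
  induction e with
  | h u v =>
    obtain ⟨p, h1, h2, -⟩ := exists_path_potential T hT w hw
      (hT.existsUnique_path u v).choose (hT.existsUnique_path u v).choose_spec.1
    have hs : (lapW T w)ᵀ = lapW T w := (lapW_isSymm T w hw).isHermitian
    change _ = w s(u, v) * treePathWeight T hT w u v
    rw [treePathWeight, ← h2, Matrix.smul_mul, trace_smul, smul_eq_mul, edgeLap_mk,
      vecMulVec_mul, trace_vecMulVec, dotProduct_comm, ← dotProduct_mulVec]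
    congr 1
    calc _ = (lapW T w *ᵥ p) ⬝ᵥ (M *ᵥ (lapW T w *ᵥ p)) := by rw [h1]
      _ = p ⬝ᵥ ((lapW T w * M * lapW T w) *ᵥ p) := by
        rw [← mulVec_mulVec, ← mulVec_mulVec, dotProduct_mulVec p, ← mulVec_transpose, hs]
      _ = _ := by
        rw [hM1, h1]; simp [dotProduct_sub]

lemma pinv_symm {V : Type*} [Fintype V] [DecidableEq V] (A M : Matrix V V ℝ)
    (hA : Aᵀ = A) (hM1 : A * M * A = A) (hM2 : M * A * M = M)
    (hM3 : (A * M)ᵀ = A * M) (hM4 : (M * A)ᵀ = M * A) : Mᵀ = M := by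
  have e3 : Mᵀ * A = A * M := by rw [← hM3, transpose_mul, hA]
  have e4 : A * Mᵀ = M * A := by rw [← hM4, transpose_mul, hA]
  have hN : A * Mᵀ * A = A := by
    have := congrArg transpose hM1
    simpa [transpose_mul, hA, mul_assoc] using this
  have hN2 : Mᵀ * A * Mᵀ = Mᵀ := by
    have := congrArg transpose hM2
    simpa [transpose_mul, hA, mul_assoc] using this
  have key : A * M = M * A := by
    have h : (A * Mᵀ) * (A * M) = A * M := by rw [← mul_assoc, hN]
    have h' := congrArg transpose h
    rw [transpose_mul, hM3, e4, hM4, ← mul_assoc, mul_assoc (A * M) M A] at h'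
    have h5 : A * M * (M * A) = M * A := by
      rw [← e4, ← mul_assoc, hM1]
    rw [h5] at h'
    exact h'.symm
  calc Mᵀ = Mᵀ * A * Mᵀ := hN2.symm
    _ = Mᵀ * (A * M) := by rw [mul_assoc, e4, key]
    _ = M := by rw [← mul_assoc, e3, key, hM2]

open scoped MatrixOrder in
lemma exists_factor {V : Type*} [Fintype V] [DecidableEq V] (M : Matrix V V ℝ)
    (hM : M.PosSemidef) : ∃ B : Matrix V V ℝ, M = Bᵀ * B := by
  obtain ⟨B, hB⟩ := CStarAlgebra.nonneg_iff_eq_star_mul_self.1 hM.nonneg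
  exact ⟨B, by simpa [star_eq_conjTranspose] using hB⟩

lemma eigen_lower {V : Type*} [Fintype V] [DecidableEq V] (L A M B : Matrix V V ℝ)
    (hM2 : M * A * M = M) (hB : M = Bᵀ * B) (hLA : (L - A).PosSemidef)
    (v : V → ℝ) (hv : v ≠ 0) (l : ℝ) (hl : l ≠ 0)
    (h : (B * L * Bᵀ) *ᵥ v = l • v) : 1 ≤ l := by
  set y := Bᵀ *ᵥ v with hy
  have hpos : 0 < v ⬝ᵥ v := by
    have := Matrix.dotProduct_star_self_pos_iff.2 hv
    simpa using this
  have hBd : ∀ a b : V → ℝ, (Bᵀ *ᵥ a) ⬝ᵥ b = a ⬝ᵥ (B *ᵥ b) := by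
    intro a b
    rw [mulVec_transpose, ← dotProduct_mulVec]
  have h1 : y ⬝ᵥ (L *ᵥ y) = l * (v ⬝ᵥ v) := by
    rw [hy, hBd, mulVec_mulVec, mulVec_mulVec, h, dotProduct_smul, smul_eq_mul]
  have h2 : y ⬝ᵥ (A *ᵥ y) = v ⬝ᵥ v := by
    have hu : v = B *ᵥ (l⁻¹ • (L *ᵥ y)) := by
      rw [mulVec_smul, hy, mulVec_mulVec, mulVec_mulVec, h, smul_smul,
        inv_mul_cancel₀ hl, one_smul]
    generalize l⁻¹ • (L *ᵥ y) = u at hu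
    have hyu : y = M *ᵥ u := by rw [hy, hu, mulVec_mulVec, hB]
    have hMs : Mᵀ = M := by rw [hB]; simp
    calc y ⬝ᵥ (A *ᵥ y) = u ⬝ᵥ ((M * A * M) *ᵥ u) := by
          rw [hyu, ← mulVec_mulVec, ← mulVec_mulVec, dotProduct_mulVec u, ← mulVec_transpose, hMs]
      _ = v ⬝ᵥ v := by
          rw [hM2, hB, ← mulVec_mulVec, ← hu, dotProduct_comm, hBd, ← hu]
  have h3 := hLA.dotProduct_mulVec_nonneg y
  rw [star_trivial, sub_mulVec, dotProduct_sub, h1, h2] at h3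
  by_contra hlt
  push Not at hlt
  nlinarith

lemma count_bound {ι : Type*} [Fintype ι] (f : ι → ℝ) (h0 : ∀ i, 0 ≤ f i) (S : ℝ)
    (hS : ∑ i, f i = S) (s : Finset ι) (hs : ∀ i ∈ s, S ^ ((2 : ℝ) / 3) < f i) :
    (s.card : ℝ) ≤ S ^ ((1 : ℝ) / 3) := by
  have hS0 : 0 ≤ S := hS ▸ Finset.sum_nonneg fun i _ => h0 i
  have hle : ∀ i, f i ≤ S := fun i => hS ▸
    Finset.single_le_sum (fun i _ => h0 i) (Finset.mem_univ i)
  rcases hS0.eq_or_lt with h | h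
  · have : s = ∅ := by
      rw [Finset.eq_empty_iff_forall_notMem]
      intro i hi
      have h1 := hs i hi
      have h2 := hle i
      have h3 : 0 ≤ S ^ ((2 : ℝ) / 3) := Real.rpow_nonneg hS0 _
      linarith
    rw [this]
    simpa using Real.rpow_nonneg hS0 _
  · have hc : (s.card : ℝ) * S ^ ((2 : ℝ) / 3) ≤ S := by
      calc (s.card : ℝ) * S ^ ((2 : ℝ) / 3) = ∑ i ∈ s, S ^ ((2 : ℝ) / 3) := by simp
        _ ≤ ∑ i ∈ s, f i := Finset.sum_le_sum fun i hi => (hs i hi).le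
        _ ≤ ∑ i, f i := Finset.sum_le_sum_of_subset_of_nonneg (Finset.subset_univ _)
            fun i _ _ => h0 i
        _ = S := hS
    have hp : 0 < S ^ ((2 : ℝ) / 3) := Real.rpow_pos_of_pos h _
    have hmul : S ^ ((1 : ℝ) / 3) * S ^ ((2 : ℝ) / 3) = S := by
      rw [← Real.rpow_add h]; norm_num
    exact le_of_mul_le_mul_right (hc.trans_eq hmul.symm) hp

lemma roots_map_complex {V : Type*} [Fintype V] [DecidableEq V] (H : Matrix V V ℝ)
    (hH : H.IsHermitian) :
    (H.charpoly.map (algebraMap ℝ ℂ)).roots =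
      Finset.univ.val.map fun i => ((hH.eigenvalues i : ℝ) : ℂ) := by
  rw [hH.charpoly_eq, Polynomial.map_prod, Polynomial.roots_prod]
  · simp
  · simp [Finset.prod_ne_zero_iff, Polynomial.X_sub_C_ne_zero]

open Polynomial in
/-- Let `S = st_T(G)`. Then (i) every eigenvalue of `L_G · M` is either `0` or a real number
in `[1, S]`; (ii) at most `S^(1/3)` eigenvalues (with multiplicity) exceed `S^(2/3)`; and in
particular all but at most `S^(1/3)` of the nonzero eigenvalues lie in `[1, S^(2/3)]`. -/
theorem eigenvalue_distribution_lap_mul_pinv {V : Type*} [Fintype V] [DecidableEq V]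
    (G T : SimpleGraph V) [DecidableRel G.Adj] [DecidableRel T.Adj]
    (hG : G.Connected) (hT : T.IsTree) (hTG : T ≤ G)
    (w : Sym2 V → ℝ) (hw : ∀ e ∈ G.edgeSet, 0 < w e)
    (M : Matrix V V ℝ)
    (hM1 : lapW T w * M * lapW T w = lapW T w)
    (hM2 : M * lapW T w * M = M)
    (hM3 : (lapW T w * M)ᵀ = lapW T w * M)
    (hM4 : (M * lapW T w)ᵀ = M * lapW T w)
    (S : ℝ) (hS : S = stretch G T hT w) :
    (∀ μ : ℂ, (((lapW G w * M).charpoly).map (algebraMap ℝ ℂ)).IsRoot μ →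
        μ = 0 ∨ (μ.im = 0 ∧ 1 ≤ μ.re ∧ μ.re ≤ S)) ∧
    ((((lapW G w * M).charpoly.map (algebraMap ℝ ℂ)).roots.filter
        fun μ => S ^ ((2 : ℝ) / 3) < μ.re).card : ℝ) ≤ S ^ ((1 : ℝ) / 3) ∧
    ((((lapW G w * M).charpoly.map (algebraMap ℝ ℂ)).roots.filter
        fun μ => μ ≠ 0 ∧ ¬(μ.im = 0 ∧ 1 ≤ μ.re ∧ μ.re ≤ S ^ ((2 : ℝ) / 3))).card : ℝ) ≤
      S ^ ((1 : ℝ) / 3) := by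
  have hwT : ∀ e ∈ T.edgeSet, 0 < w e := fun e he =>
    hw e (SimpleGraph.edgeSet_mono hTG he)
  have hA := lapW_isSymm T w hwT
  have hAs : (lapW T w)ᵀ = lapW T w := hA.isHermitian
  have hMs : Mᵀ = M := pinv_symm _ _ hAs hM1 hM2 hM3 hM4
  have hMp : M.PosSemidef := by
    have := hA.conjTranspose_mul_mul_same M
    rwa [conjTranspose_eq_transpose_of_trivial, hMs, hM2] at this
  obtain ⟨B, hB⟩ := exists_factor M hMp
  have hH : (B * lapW G w * Bᵀ).PosSemidef := by
    have := (lapW_isSymm G w hw).mul_mul_conjTranspose_same B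
    rwa [conjTranspose_eq_transpose_of_trivial] at this
  have hchar : (lapW G w * M).charpoly = (B * lapW G w * Bᵀ).charpoly := by
    rw [hB, ← mul_assoc, charpoly_mul_comm, ← mul_assoc]
  have hroots := roots_map_complex _ hH.isHermitian
  rw [← hchar] at hroots
  set f := hH.isHermitian.eigenvalues with hf
  have h0 : ∀ i, 0 ≤ f i := hH.eigenvalues_nonneg
  have hsum : ∑ i, f i = S := by
    have h1 := hH.isHermitian.trace_eq_sum_eigenvalues
    have h2 := trace_lapW_mul G T hT w hwT M hM1
    rw [hB, ← mul_assoc, trace_mul_comm, ← mul_assoc] at h2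
    rw [hS, ← h2, h1]
    simp [hf]
  have hle : ∀ i, f i ≤ S := fun i => hsum ▸
    Finset.single_le_sum (fun i _ => h0 i) (Finset.mem_univ i)
  have h1 : ∀ i, f i ≠ 0 → 1 ≤ f i := by
    intro i hi
    refine eigen_lower (lapW G w) (lapW T w) M B hM2 hB (lapW_sub_posSemidef G T hTG w hw)
      (hH.isHermitian.eigenvectorBasis i).ofLp ?_ (f i) hi
      (hH.isHermitian.mulVec_eigenvectorBasis i)
    intro h
    have := hH.isHermitian.eigenvectorBasis.orthonormal.ne_zero i
    exact this (by ext j; simpa using congrFun h j)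
  refine ⟨?_, ?_, ?_⟩
  · intro μ hμ
    have hne : (lapW G w * M).charpoly.map (algebraMap ℝ ℂ) ≠ 0 :=
      ((charpoly_monic _).map _).ne_zero
    have hmem := (Polynomial.mem_roots hne).2 hμ
    rw [hroots, Multiset.mem_map] at hmem
    obtain ⟨i, -, rfl⟩ := hmem
    by_cases hi : f i = 0
    · left; simp [hi]
    · right; exact ⟨by simp, by simpa using h1 i hi, by simpa using hle i⟩
  · rw [hroots, Multiset.filter_map, Multiset.card_map]
    refine count_bound f h0 S hsum (Finset.univ.filter fun i => S ^ ((2 : ℝ) / 3) < f i) ?_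
    intro i hi
    simpa using hi
  · rw [hroots, Multiset.filter_map, Multiset.card_map]
    refine count_bound f h0 S hsum (Finset.univ.filter fun i =>
      ((f i : ℝ) : ℂ) ≠ 0 ∧ ¬(((f i : ℝ) : ℂ).im = 0 ∧ 1 ≤ ((f i : ℝ) : ℂ).re ∧
        ((f i : ℝ) : ℂ).re ≤ S ^ ((2 : ℝ) / 3))) ?_
    intro i hi
    simp only [Finset.mem_filter, Finset.mem_univ, true_and, Complex.ofReal_im,
      Complex.ofReal_re, ne_eq, Complex.ofReal_eq_zero] at hi
    by_contra hlt
    exact hi.2 ⟨h1 i hi.1, not_lt.1 hlt⟩
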